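/- arXiv:1401.1722 — 2 statements merged into one kernel-verified Lean document; each statement's English description precedes it below -/
import Mathlib

section
/- Let A and B be rings and (M, N, η, ρ) a Morita context between A and B with trace ideals I ⊆ A and J ⊆ B. Let V be a simple left A-module with I·V = V, and let S ⊆ Hom_A(M, V) be the image of the B-linear map η̄_V : N ⊗_A V → Hom_A(M, V), n ⊗ v ↦ (m ↦ η(m⊗n)·v). Then S is a simple left B-module; moreover J·Y = S for every nonzero B-submodule Y of Hom_A(M, V), so S is the unique minimal nonzero B-submodule (the simple socle) of Hom_A(M, V); and dually, every proper B-submodule of N ⊗_A V is contained in ker(η̄_V), so S is the unique simple quotient (the simple top) of N ⊗_A V. -/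
open MulOpposite
open scoped TensorProduct

universe u

section MoritaSetup

variable (A B M N : Type u) [Ring A] [Ring B]
  [AddCommGroup M] [AddCommGroup N]
  [Module A M] [Module Bᵐᵒᵖ M] [SMulCommClass A Bᵐᵒᵖ M]
  [Module B N] [Module Aᵐᵒᵖ N] [SMulCommClass B Aᵐᵒᵖ N]

/-- A Morita context between rings `A` and `B`, presented via the balanced biadditive
pairings corresponding to the bimodule homomorphisms `η : M ⊗[B] N → A` and
`ρ : N ⊗[A] M → B` satisfying the associativity laws. -/
structure MoritaPairing where
  eta : M → N → A
  rho : N → M → B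
  eta_add_left : ∀ m m' n, eta (m + m') n = eta m n + eta m' n
  eta_add_right : ∀ m n n', eta m (n + n') = eta m n + eta m n'
  eta_smul_left : ∀ (a : A) m n, eta (a • m) n = a * eta m n
  eta_smul_right : ∀ (a : A) m n, eta m (op a • n) = eta m n * a
  eta_balanced : ∀ (b : B) m n, eta (op b • m) n = eta m (b • n)
  rho_add_left : ∀ n n' m, rho (n + n') m = rho n m + rho n' m
  rho_add_right : ∀ n m m', rho n (m + m') = rho n m + rho n m'
  rho_smul_left : ∀ (b : B) n m, rho (b • n) m = b * rho n m
  rho_smul_right : ∀ (b : B) n m, rho n (op b • m) = rho n m * b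
  rho_balanced : ∀ (a : A) n m, rho (op a • n) m = rho n (a • m)
  assoc_M : ∀ m n m', eta m n • m' = op (rho n m') • m
  assoc_N : ∀ n m n', rho n m • n' = op (eta m n') • n

variable {A B M N}

section HomModule

variable (V : Type u) [AddCommGroup V] [Module A V]

/-- `Hom_A(M, V)` is a left `B`-module via the right `B`-action on `M`:
`(b • φ) m = φ (m · b)`. -/
instance instSMulHomDom : SMul B (M →ₗ[A] V) :=
  ⟨fun b φ =>
    { toFun := fun m => φ (op b • m)
      map_add' := fun x y => by
        show φ (op b • (x + y)) = φ (op b • x) + φ (op b • y)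
        rw [smul_add, map_add]
      map_smul' := fun a x => by
        show φ (op b • (a • x)) = a • φ (op b • x)
        rw [← smul_comm, map_smul] }⟩

theorem domSMul_apply (b : B) (φ : M →ₗ[A] V) (m : M) : (b • φ) m = φ (op b • m) := rfl

instance instModuleHomDom : Module B (M →ₗ[A] V) where
  one_smul φ := by ext m; simp [domSMul_apply]
  mul_smul b b' φ := by ext m; simp [domSMul_apply, op_mul, mul_smul]
  smul_zero b := by ext m; simp [domSMul_apply]
  smul_add b φ φ' := by ext m; simp [domSMul_apply]
  add_smul b b' φ := by ext m; simp [domSMul_apply, op_add, add_smul]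
  zero_smul φ := by ext m; simp [domSMul_apply]

end HomModule

variable (P : MoritaPairing A B M N)

/-- `I • V = V`, where `I = im η ⊆ A` is the trace ideal. -/
def IFull (V : Type u) [AddCommGroup V] [Module A V] : Prop :=
  Submodule.span A {x : V | ∃ (m : M) (n : N) (v : V), x = P.eta m n • v} = ⊤

/-- The image `S` of the `B`-linear map `η̄_V : N ⊗[A] V → Hom_A(M, V)`,
`n ⊗ v ↦ (m ↦ η(m ⊗ n) • v)`. -/
def imageEtaBar (V : Type u) [AddCommGroup V] [Module A V] : Submodule B (M →ₗ[A] V) :=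
  Submodule.span B {φ : M →ₗ[A] V | ∃ (n : N) (v : V), ∀ m : M, φ m = P.eta m n • v}

section EtaBar

variable (V : Type u) [AddCommGroup V] [Module A V]

/-- `m ↦ η(m ⊗ n) • v`, as an `A`-linear map `M →ₗ[A] V`. -/
def etaPairMap (n : N) (v : V) : M →ₗ[A] V where
  toFun m := P.eta m n • v
  map_add' m m' := by
    show P.eta (m + m') n • v = P.eta m n • v + P.eta m' n • v
    rw [P.eta_add_left, add_smul]
  map_smul' a m := by
    show P.eta (a • m) n • v = a • (P.eta m n • v)
    rw [P.eta_smul_left, mul_smul]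

/-- The pairing underlying `η̄_V`, as a biadditive map. -/
def etaBarHom : N →+ V →+ (M →ₗ[A] V) :=
  AddMonoidHom.mk'
    (fun n => AddMonoidHom.mk' (fun v => etaPairMap P V n v)
      (fun v v' => by ext m; simp [etaPairMap, smul_add]))
    (fun n n' => by ext v m; simp [etaPairMap, P.eta_add_right, add_smul])

/-- The map `η̄_V` defined on the `ℤ`-tensor product `N ⊗[ℤ] V`. -/
noncomputable def etaBar : N ⊗[ℤ] V →+ (M →ₗ[A] V) :=
  TensorProduct.liftAddHom (etaBarHom P V)
    (fun z n v => by simp [map_zsmul])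

/-- The submodule of balancing relations defining `N ⊗[A] V` as a quotient of the
`ℤ`-tensor product `N ⊗[ℤ] V`. -/
def relNV : Submodule B (N ⊗[ℤ] V) :=
  Submodule.span B {x : N ⊗[ℤ] V |
    ∃ (a : A) (n : N) (v : V), x = (op a • n) ⊗ₜ[ℤ] v - n ⊗ₜ[ℤ] (a • v)}

end EtaBar

theorem rho_smul_hom (V : Type u) [AddCommGroup V] [Module A V]
    (n : N) (m : M) (ψ : M →ₗ[A] V) : P.rho n m • ψ = etaPairMap P V n (ψ m) := by
  ext m'
  rw [domSMul_apply, ← P.assoc_M, map_smul]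
  rfl

theorem exists_smul_eq_of_simple (V : Type u) [AddCommGroup V] [Module A V]
    (hV : IsSimpleModule A V) {w : V} (hw : w ≠ 0) (v : V) : ∃ a : A, a • w = v :=
  IsSimpleModule.toSpanSingleton_surjective A hw v

theorem span_rho_eq (V : Type u) [AddCommGroup V] [Module A V]
    (hV : IsSimpleModule A V) (Y : Submodule B (M →ₗ[A] V)) (hY : Y ≠ ⊥) :
    Submodule.span B {x : M →ₗ[A] V | ∃ (n : N) (m : M), ∃ ψ ∈ Y, x = P.rho n m • ψ}
        = imageEtaBar P V := by
  apply le_antisymm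
  · rw [Submodule.span_le]
    rintro x ⟨n, m, ψ, -, rfl⟩
    rw [rho_smul_hom]
    exact Submodule.subset_span ⟨n, ψ m, fun _ => rfl⟩
  · obtain ⟨ψ, hψ, h0⟩ := Submodule.exists_mem_ne_zero_of_ne_bot hY
    obtain ⟨m, hm⟩ : ∃ m, ψ m ≠ 0 := by
      by_contra! h
      exact h0 (LinearMap.ext h)
    refine Submodule.span_le.2 ?_
    rintro φ ⟨n, v, hφ⟩
    obtain ⟨a, rfl⟩ := exists_smul_eq_of_simple V hV hm v
    refine Submodule.subset_span ⟨n, a • m, ψ, hψ, ?_⟩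
    rw [rho_smul_hom, map_smul]
    exact LinearMap.ext hφ

theorem rho_smul_tensor (V : Type u) [AddCommGroup V] [Module A V]
    (n : N) (m : M) (x : N ⊗[ℤ] V) :
    P.rho n m • x - n ⊗ₜ[ℤ] (etaBar P V x m) ∈ relNV (A := A) (B := B) (N := N) V := by
  induction x using TensorProduct.induction_on with
  | zero => simp
  | tmul n' v' =>
    rw [TensorProduct.smul_tmul', P.assoc_N]
    exact Submodule.subset_span ⟨P.eta m n', n, v', rfl⟩
  | add x y hx hy =>
    have := add_mem hx hy
    rw [map_add, LinearMap.add_apply, TensorProduct.tmul_add, smul_add]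
    rwa [add_sub_add_comm]

/-- Let `(M, N, η, ρ)` be a Morita context between rings `A` and `B`
with trace ideals `I ⊆ A` and `J ⊆ B`, and let `V` be a simple left `A`-module with
`I•V = V`.  Let `S ⊆ Hom_A(M, V)` be the image of `η̄_V`.  Then `S` is a simple
`B`-module; `J•Y = S` for every nonzero `B`-submodule `Y` of `Hom_A(M, V)` (so `S` is the
simple socle of `Hom_A(M, V)`); and every proper `B`-submodule of `N ⊗[A] V` is contained
in `ker η̄_V` (so `S` is the simple top of `N ⊗[A] V`).  Here `N ⊗[A] V` is realized as
the quotient of `N ⊗[ℤ] V` by the balancing relations `relNV`, so that its `B`-submodules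
are the `B`-submodules of `N ⊗[ℤ] V` containing `relNV`. -/
theorem simple_socle_and_top_of_morita
    (V : Type u) [AddCommGroup V] [Module A V]
    (hV : IsSimpleModule A V) (hIV : IFull P V) :
    IsSimpleModule B (imageEtaBar P V) ∧
    (∀ Y : Submodule B (M →ₗ[A] V), Y ≠ ⊥ →
      Submodule.span B {x : M →ₗ[A] V | ∃ (n : N) (m : M), ∃ ψ ∈ Y, x = P.rho n m • ψ}
        = imageEtaBar P V) ∧
    (∀ Y : Submodule B (N ⊗[ℤ] V), relNV (A := A) (B := B) (N := N) V ≤ Y → Y ≠ ⊤ →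
      ∀ x ∈ Y, etaBar P V x = 0) := by
  refine ⟨?_, span_rho_eq P V hV, ?_⟩
  · rw [isSimpleModule_iff_isAtom]
    refine ⟨?_, ?_⟩
    · intro h
      have hnt : Nontrivial V := IsSimpleModule.nontrivial A V
      have hz : Submodule.span A {x : V | ∃ (m : M) (n : N) (v : V), x = P.eta m n • v} ≤ ⊥ := by
        rw [Submodule.span_le]
        rintro x ⟨m, n, v, rfl⟩
        have hmem : etaPairMap P V n v ∈ imageEtaBar P V :=
          Submodule.subset_span ⟨n, v, fun _ => rfl⟩
        rw [h, Submodule.mem_bot] at hmem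
        exact LinearMap.congr_fun hmem m
      unfold IFull at hIV
      rw [hIV] at hz
      exact top_ne_bot (le_bot_iff.1 hz)
    · intro Y hY
      by_contra hne
      apply hY.not_ge
      rw [← span_rho_eq P V hV Y hne, Submodule.span_le]
      rintro x ⟨n, m, ψ, hψ, rfl⟩
      exact Y.smul_mem _ hψ
  · intro Y hrel hY x hx
    by_contra h0
    obtain ⟨m, hm⟩ : ∃ m, etaBar P V x m ≠ 0 := by
      by_contra! h
      exact h0 (LinearMap.ext h)
    apply hY
    rw [eq_top_iff]
    rintro y -
    induction y using TensorProduct.induction_on with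
    | zero => exact Y.zero_mem
    | add y z hy hz => exact Y.add_mem hy hz
    | tmul n v =>
      obtain ⟨a, rfl⟩ := exists_smul_eq_of_simple V hV hm v
      have h1 := hrel (rho_smul_tensor P V (op a • n) m x)
      have h2 : (op a • n) ⊗ₜ[ℤ] (etaBar P V x m) - n ⊗ₜ[ℤ] (a • etaBar P V x m) ∈ Y :=
        hrel (Submodule.subset_span ⟨a, n, _, rfl⟩)
      have h3 := Y.smul_mem (P.rho (op a • n) m) hx
      have h4 := Y.sub_mem (Y.sub_mem h3 h1) h2
      simpa using h4

end MoritaSetup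
end

section
/- Let A and B be rings and (M, N, η, ρ) a Morita context between A and B with trace ideal J := im(ρ) ⊆ B. Then for every left A-module V, one has J·Hom_A(M, V) ⊆ im(η̄_V); that is, the quotient B-module Hom_A(M, V)/im(η̄_V) is annihilated by J. -/
open MulOpposite

universe u

section MoritaSetup

variable (A B M N : Type u) [Ring A] [Ring B]
  [AddCommGroup M] [AddCommGroup N]
  [Module A M] [Module Bᵐᵒᵖ M] [SMulCommClass A Bᵐᵒᵖ M]
  [Module B N] [Module Aᵐᵒᵖ N] [SMulCommClass B Aᵐᵒᵖ N]

variable {A B M N}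

variable (P : MoritaPairing A B M N)

/-- For a Morita context `(M, N, η, ρ)` between rings `A` and `B` with
trace ideal `J = im ρ ⊆ B`, and every left `A`-module `V`, one has
`J • Hom_A(M, V) ⊆ im η̄_V`. -/
theorem traceIdeal_smul_hom_le_image_etaBar
    (V : Type u) [AddCommGroup V] [Module A V] :
    Submodule.span B {x : M →ₗ[A] V |
        ∃ (n : N) (m : M) (ψ : M →ₗ[A] V), x = P.rho n m • ψ} ≤ imageEtaBar P V := by
  unfold imageEtaBar
  refine Submodule.span_mono ?_
  rintro x ⟨n, m, ψ, rfl⟩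
  refine ⟨n, ψ m, fun m' => ?_⟩
  rw [domSMul_apply, ← P.assoc_M, map_smul]

end MoritaSetup
end
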